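/- Let A, B, C, D be types, let f : A → B, g : A → C, H : A → D be functions, and let N ≥ 1 be a natural number. Define the binary relation R₀ on A by R₀(a, a') iff f(a) = f(a') or g(a) = g(a'), and inductively define R_{n+1}(a, c) iff there exists b with R₀(a, b) and R_n(b, c). Assume: (i) for all a, a', f(a) = f(a') implies H(a) = H(a'); (ii) for all a, a', g(a) = g(a') implies H(a) = H(a'); (iii) every fiber of H has at most N elements. Then: (1) R_N is an equivalence relation on A and coincides with the equivalence relation generated by R₀ (so the transitive closure of R₀ is attained after N steps); (2) every equivalence class of the generated equivalence relation is contained in a single fiber of H, hence has at most N elements; (3) for every type E and every function K : A → E such that f(a) = f(a') implies K(a) = K(a') and g(a) = g(a') implies K(a) = K(a') for all a, a', one has K(a) = K(a') whenever a and a' are related by the equivalence relation generated by R₀. -/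

import Mathlib

/-- The relation `R₀(a,a')` iff `f a = f a'` or `g a = g a'`. -/
def R0 {A B C : Type*} (f : A → B) (g : A → C) (a a' : A) : Prop :=
  f a = f a' ∨ g a = g a'

/-- The iterated relations: `R 0 = R₀` and `R (n+1) a c` iff `∃ b, R₀ a b ∧ R n b c`. -/
def RChain {A B C : Type*} (f : A → B) (g : A → C) : ℕ → A → A → Prop
  | 0 => R0 f g
  | n + 1 => fun a c => ∃ b, R0 f g a b ∧ RChain f g n b c

section

variable {A B C : Type*} {f : A → B} {g : A → C}

theorem R0.refl (a : A) : R0 f g a a := Or.inl rfl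

theorem R0.symm {a b : A} (h : R0 f g a b) : R0 f g b a :=
  Or.imp Eq.symm Eq.symm h

theorem RChain.refl (n : ℕ) (a : A) : RChain f g n a a := by
  induction n with
  | zero => exact R0.refl a
  | succ n ih => exact ⟨a, R0.refl a, ih⟩

theorem RChain.succ {n : ℕ} {a c : A} (h : RChain f g n a c) : RChain f g (n + 1) a c :=
  ⟨a, R0.refl a, h⟩

theorem RChain.eqvGen {n : ℕ} {a c : A} (h : RChain f g n a c) :
    Relation.EqvGen (R0 f g) a c := by
  induction n generalizing a with
  | zero => exact .rel _ _ h
  | succ n ih =>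
    obtain ⟨b, hab, hbc⟩ := h
    exact .trans _ _ _ (.rel _ _ hab) (ih hbc)

/-- A function factoring both `f` and `g` is constant on classes of the generated
equivalence relation. -/
theorem eq_of_eqvGen_R0 {E : Type*} {K : A → E} (hf : ∀ a a', f a = f a' → K a = K a')
    (hg : ∀ a a', g a = g a' → K a = K a') {a a' : A}
    (h : Relation.EqvGen (R0 f g) a a') : K a = K a' := by
  induction h with
  | rel x y h => exact h.elim (hf x y) (hg x y)
  | refl => rfl
  | symm _ _ _ ih => exact ih.symm
  | trans _ _ _ _ _ ih₁ ih₂ => exact ih₁.trans ih₂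

/-- As long as the chains ending at `c` have not stabilized, each step adds a new point. -/
theorem RChain.lt_ncard_of_not_subset {c : A}
    (hfin : {a | Relation.EqvGen (R0 f g) a c}.Finite) {n : ℕ}
    (h : ¬ {a | RChain f g (n + 1) a c} ⊆ {a | RChain f g n a c}) :
    n < {a | RChain f g n a c}.ncard := by
  have fin (m : ℕ) : {a | RChain f g m a c}.Finite := hfin.subset fun _ ha => ha.eqvGen
  induction n with
  | zero => exact (Set.ncard_pos (fin 0)).2 ⟨c, RChain.refl 0 c⟩
  | succ n ih =>
    have hn : ¬ {a | RChain f g (n + 1) a c} ⊆ {a | RChain f g n a c} := fun hs =>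
      h fun _ ⟨b, hab, hbc⟩ => ⟨b, hab, hs hbc⟩
    exact (Nat.succ_le_of_lt (ih hn)).trans_lt
      (Set.ncard_lt_ncard ⟨fun _ ha => RChain.succ ha, hn⟩ (fin (n + 1)))

/-- A class with at most `n` elements is exhausted by chains of index `n`. -/
theorem RChain.of_eqvGen {c : A} {n : ℕ}
    (hfin : {a | Relation.EqvGen (R0 f g) a c}.Finite)
    (hcard : {a | Relation.EqvGen (R0 f g) a c}.ncard ≤ n) {a : A}
    (h : Relation.EqvGen (R0 f g) a c) : RChain f g n a c := by
  have hclosed : {a | RChain f g (n + 1) a c} ⊆ {a | RChain f g n a c} := by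
    by_contra hs
    exact (RChain.lt_ncard_of_not_subset hfin hs).not_ge
      ((Set.ncard_le_ncard (fun _ ha => RChain.eqvGen ha) hfin).trans hcard)
  have key {x y : A} (hxy : Relation.EqvGen (R0 f g) x y) :
      RChain f g n x c ↔ RChain f g n y c := by
    induction hxy with
    | rel x y hxy => exact ⟨fun hx => hclosed ⟨x, hxy.symm, hx⟩, fun hy => hclosed ⟨y, hxy, hy⟩⟩
    | refl => rfl
    | symm _ _ _ ih => exact ih.symm
    | trans _ _ _ _ _ ih₁ ih₂ => exact ih₁.trans ih₂
  exact (key h).2 (RChain.refl n c)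

end

/-- If `f` and `g` are both initial factors of `H`, whose fibers have at most `N ≥ 1`
elements, then: (1) `R_N` is an equivalence relation and equals the equivalence relation
generated by `R₀` (the transitive closure stabilizes after `N` steps); (2) every class of
the generated equivalence relation is contained in a single fiber of `H`, so has at most
`N` elements; (3) any `K` of which both `f` and `g` are initial factors is constant on the
classes of the generated equivalence relation. -/
theorem leastclosing_core {A B C D : Type*}
    (f : A → B) (g : A → C) (H : A → D) (N : ℕ) (hN : 1 ≤ N)
    (hf : ∀ a a', f a = f a' → H a = H a')
    (hg : ∀ a a', g a = g a' → H a = H a')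
    (hfib : ∀ d : D, (H ⁻¹' {d}).Finite ∧ (H ⁻¹' {d}).ncard ≤ N) :
    (Equivalence (RChain f g N) ∧
      ∀ a a', RChain f g N a a' ↔ Relation.EqvGen (R0 f g) a a') ∧
    ((∀ a a', Relation.EqvGen (R0 f g) a a' → H a = H a') ∧
      ∀ a : A, ({a' | Relation.EqvGen (R0 f g) a a'}).Finite ∧
        ({a' | Relation.EqvGen (R0 f g) a a'}).ncard ≤ N) ∧
    (∀ (E : Type*) (K : A → E),
      (∀ a a', f a = f a' → K a = K a') →
      (∀ a a', g a = g a' → K a = K a') →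
      ∀ a a', Relation.EqvGen (R0 f g) a a' → K a = K a') := by
  have hH {a a' : A} (h : Relation.EqvGen (R0 f g) a a') : H a = H a' := eq_of_eqvGen_R0 hf hg h
  have hiff (a a' : A) : RChain f g N a a' ↔ Relation.EqvGen (R0 f g) a a' := by
    have hsub : {x | Relation.EqvGen (R0 f g) x a'} ⊆ H ⁻¹' {H a'} := fun _ hx => hH hx
    obtain ⟨hfin, hcard⟩ := hfib (H a')
    exact ⟨RChain.eqvGen, RChain.of_eqvGen (hfin.subset hsub)
      ((Set.ncard_le_ncard hsub hfin).trans hcard)⟩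
  refine ⟨⟨?_, hiff⟩, ⟨fun _ _ => hH, fun a => ?_⟩, fun _ _ hKf hKg _ _ => eq_of_eqvGen_R0 hKf hKg⟩
  · have hEq : RChain f g N = Relation.EqvGen (R0 f g) :=
      funext₂ fun a a' => propext (hiff a a')
    exact hEq ▸ Relation.EqvGen.is_equivalence _
  · have hsub : {x | Relation.EqvGen (R0 f g) a x} ⊆ H ⁻¹' {H a} := fun _ hx => (hH hx).symm
    obtain ⟨hfin, hcard⟩ := hfib (H a)
    exact ⟨hfin.subset hsub, (Set.ncard_le_ncard hsub hfin).trans hcard⟩
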